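/- Let m ≥ 1 be an integer. There exists a constant c > 0, depending only on m, such that for all smooth periodic functions v, u₁, u₂ : ℝ² → ℝ, ‖A^{m−1}(v(u₁² + u₁u₂ + u₂²))‖² ≤ c ‖A^m v‖² (‖A^m u₁‖⁴ + ‖A^m u₂‖⁴). -/

import Mathlib

open MeasureTheory Real Filter

noncomputable section

/-- A function `u : ℝ² → ℝ` is smooth periodic if it is `C^∞` and `2π`-periodic
in each variable. -/
def SmoothPeriodic (u : ℝ × ℝ → ℝ) : Prop :=
  ContDiff ℝ (⊤ : ℕ∞) u ∧ (∀ x y, u (x + 2 * Real.pi, y) = u (x, y)) ∧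
    (∀ x y, u (x, y + 2 * Real.pi) = u (x, y))

/-- Partial derivative in the first variable. -/
def pdx (u : ℝ × ℝ → ℝ) : ℝ × ℝ → ℝ := fun p => fderiv ℝ u p (1, 0)

/-- Partial derivative in the second variable. -/
def pdy (u : ℝ × ℝ → ℝ) : ℝ × ℝ → ℝ := fun p => fderiv ℝ u p (0, 1)

/-- The fundamental domain `[0, 2π]²`. -/
def sq2 : Set (ℝ × ℝ) := Set.Icc (0 : ℝ) (2 * Real.pi) ×ˢ Set.Icc (0 : ℝ) (2 * Real.pi)

/-- The `L²` inner product over `[0, 2π]²`. -/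
def l2inner (u v : ℝ × ℝ → ℝ) : ℝ := ∫ p in sq2, u p * v p

/-- The `L²` norm over `[0, 2π]²`. -/
def l2norm (u : ℝ × ℝ → ℝ) : ℝ := Real.sqrt (∫ p in sq2, (u p) ^ 2)

/-- The `L^q` norm over `[0, 2π]²`. -/
def lpnorm (q : ℝ) (u : ℝ × ℝ → ℝ) : ℝ := (∫ p in sq2, |u p| ^ q) ^ (1 / q)

/-- The operator `A = -Δ + 1`. -/
def Aop (u : ℝ × ℝ → ℝ) : ℝ × ℝ → ℝ :=
  fun p => -(pdx (pdx u) p + pdy (pdy u) p) + u p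

/-- The pointwise dot product of gradients, `∇v ⋅ ∇w`. -/
def gradDot (v w : ℝ × ℝ → ℝ) : ℝ × ℝ → ℝ :=
  fun p => pdx v p * pdx w p + pdy v p * pdy w p

/-- The nonlinearity `f(u) = (a+3)u − 4Au + b|∇u|² + u³`. -/
def fNL (a b : ℝ) (u : ℝ × ℝ → ℝ) : ℝ × ℝ → ℝ :=
  fun p => (a + 3) * u p - 4 * Aop u p + b * gradDot u u p + (u p) ^ 3

namespace SmoothPeriodic

variable {u v : ℝ × ℝ → ℝ}

lemma differentiable (hu : SmoothPeriodic u) : Differentiable ℝ u :=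
  hu.1.differentiable (by simp)

lemma continuous (hu : SmoothPeriodic u) : Continuous u := hu.1.continuous

lemma contDiff_fderiv_apply (hu : SmoothPeriodic u) (e : ℝ × ℝ) :
    ContDiff ℝ (⊤ : ℕ∞) fun p => fderiv ℝ u p e :=
  (hu.1.fderiv_right (m := (⊤ : ℕ∞)) (by simp)).clm_apply contDiff_const

lemma fderiv_add_period {a : ℝ × ℝ} (h : ∀ p, u (p + a) = u p) (p : ℝ × ℝ) :
    fderiv ℝ u (p + a) = fderiv ℝ u p := by
  rw [← fderiv_comp_add_right]
  congr 1
  exact funext h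

lemma fderiv_apply (hu : SmoothPeriodic u) (e : ℝ × ℝ) :
    SmoothPeriodic fun p => fderiv ℝ u p e := by
  refine ⟨hu.contDiff_fderiv_apply e, fun x y => ?_, fun x y => ?_⟩
  · have := fderiv_add_period (u := u) (a := (2 * Real.pi, 0))
      (fun ⟨x, y⟩ => by simpa using hu.2.1 x y) (x, y)
    simp only [Prod.mk_add_mk, add_zero] at this
    simp only [this]
  · have := fderiv_add_period (u := u) (a := (0, 2 * Real.pi))
      (fun ⟨x, y⟩ => by simpa using hu.2.2 x y) (x, y)
    simp only [Prod.mk_add_mk, add_zero] at this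
    simp only [this]

lemma pdx (hu : SmoothPeriodic u) : SmoothPeriodic (pdx u) := hu.fderiv_apply (1, 0)

lemma pdy (hu : SmoothPeriodic u) : SmoothPeriodic (pdy u) := hu.fderiv_apply (0, 1)

lemma add (hu : SmoothPeriodic u) (hv : SmoothPeriodic v) :
    SmoothPeriodic fun p => u p + v p :=
  ⟨hu.1.add hv.1, fun x y => by simp only [hu.2.1, hv.2.1],
    fun x y => by simp only [hu.2.2, hv.2.2]⟩

lemma neg (hu : SmoothPeriodic u) : SmoothPeriodic fun p => -u p :=
  ⟨hu.1.neg, fun x y => by simp only [hu.2.1], fun x y => by simp only [hu.2.2]⟩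

lemma mul (hu : SmoothPeriodic u) (hv : SmoothPeriodic v) :
    SmoothPeriodic fun p => u p * v p :=
  ⟨hu.1.mul hv.1, fun x y => by simp only [hu.2.1, hv.2.1],
    fun x y => by simp only [hu.2.2, hv.2.2]⟩

lemma aop (hu : SmoothPeriodic u) : SmoothPeriodic (Aop u) :=
  (hu.pdx.pdx.add hu.pdy.pdy).neg.add hu

lemma iterate_aop (hu : SmoothPeriodic u) (n : ℕ) : SmoothPeriodic (Aop^[n] u) := by
  induction n with
  | zero => exact hu
  | succ n ih => rw [Function.iterate_succ_apply']; exact ih.aop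

lemma fderiv_add_apply (hu : SmoothPeriodic u) (hv : SmoothPeriodic v) (e : ℝ × ℝ) :
    (fun p => fderiv ℝ (fun p => u p + v p) p e) =
      fun p => fderiv ℝ u p e + fderiv ℝ v p e := by
  funext p
  rw [fderiv_fun_add (hu.differentiable p) (hv.differentiable p)]
  rfl

lemma fderiv_mul_apply (hu : SmoothPeriodic u) (hv : SmoothPeriodic v) (e : ℝ × ℝ) :
    (fun p => fderiv ℝ (fun p => u p * v p) p e) =
      fun p => fderiv ℝ u p e * v p + u p * fderiv ℝ v p e := by
  funext p
  rw [fderiv_fun_mul (hu.differentiable p) (hv.differentiable p)]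
  simp
  ring

lemma fderiv_neg_apply (u : ℝ × ℝ → ℝ) (e : ℝ × ℝ) :
    (fun p => fderiv ℝ (fun p => -u p) p e) = fun p => -fderiv ℝ u p e := by
  funext p
  rw [fderiv_fun_neg]
  rfl

lemma fderiv_apply_comm (hu : SmoothPeriodic u) (e e' : ℝ × ℝ) (p : ℝ × ℝ) :
    fderiv ℝ (fun q => fderiv ℝ u q e) p e' = fderiv ℝ (fun q => fderiv ℝ u q e') p e := by
  have hd : DifferentiableAt ℝ (fderiv ℝ u) p :=
    ((hu.1.fderiv_right (m := (⊤ : ℕ∞)) (by simp)).differentiable (by simp)) p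
  have hs : IsSymmSndFDerivAt ℝ u p :=
    hu.1.contDiffAt.isSymmSndFDerivAt (by
      rw [minSmoothness_of_isRCLikeNormedField]
      exact WithTop.coe_le_coe.2 (le_top : (2 : ℕ∞) ≤ ⊤))
  rw [fderiv_clm_apply hd (by fun_prop), fderiv_clm_apply hd (by fun_prop)]
  simpa using hs e' e

lemma fderiv_aop_apply (hu : SmoothPeriodic u) (e : ℝ × ℝ) :
    (fun p => fderiv ℝ (Aop u) p e) = Aop fun p => fderiv ℝ u p e := by
  have key : ∀ e', (fun p => fderiv ℝ (fun q => fderiv ℝ (fun r => fderiv ℝ u r e') q e') p e) =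
      fun p => fderiv ℝ (fun q => fderiv ℝ (fun r => fderiv ℝ u r e) q e') p e' := by
    intro e'
    funext p
    rw [(hu.fderiv_apply e').fderiv_apply_comm]
    congr 2
    funext q
    exact hu.fderiv_apply_comm _ _ _
  have h₁ := (hu.pdx.pdx.add hu.pdy.pdy).neg.fderiv_add_apply hu e
  have h₂ := hu.pdx.pdx.fderiv_add_apply hu.pdy.pdy e
  have h₃ := fderiv_neg_apply (fun p => _root_.pdx (_root_.pdx u) p + _root_.pdy (_root_.pdy u) p) e
  funext p
  refine (congrFun h₁ p).trans ?_
  rw [congrFun h₃ p, congrFun h₂ p]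
  have kx := congrFun (key (1, 0)) p
  have ky := congrFun (key (0, 1)) p
  exact congrArg₂ (fun a b => -(a + b) + fderiv ℝ u p e) kx ky

lemma fderiv_iterate_aop_apply (hu : SmoothPeriodic u) (e : ℝ × ℝ) (n : ℕ) :
    (fun p => fderiv ℝ (Aop^[n] u) p e) = Aop^[n] fun p => fderiv ℝ u p e := by
  induction n with
  | zero => rfl
  | succ n ih =>
    rw [Function.iterate_succ_apply', (hu.iterate_aop n).fderiv_aop_apply, ih,
      Function.iterate_succ_apply']

end SmoothPeriodic

lemma isCompact_sq2 : IsCompact sq2 := isCompact_Icc.prod isCompact_Icc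

lemma measurableSet_sq2 : MeasurableSet sq2 := isCompact_sq2.measurableSet

lemma integrableOn_sq2 {f : ℝ × ℝ → ℝ} (hf : Continuous f) : IntegrableOn f sq2 :=
  hf.continuousOn.integrableOn_compact isCompact_sq2

lemma volume_real_sq2 : volume.real sq2 = (2 * π) ^ 2 := by
  have : 0 ≤ 2 * π := by positivity
  rw [sq2, Measure.volume_eq_prod, measureReal_prod_prod]
  simp [this, sq]

lemma setIntegral_sq2 {f : ℝ × ℝ → ℝ} (hf : Continuous f) :
    ∫ p in sq2, f p = ∫ x in 0..2 * π, ∫ y in 0..2 * π, f (x, y) := by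
  have : 0 ≤ 2 * π := by positivity
  have hi := integrableOn_sq2 hf
  rw [sq2, Measure.volume_eq_prod] at *
  rw [setIntegral_prod _ hi]
  simp only [intervalIntegral.integral_of_le this, integral_Icc_eq_integral_Ioc]

lemma setIntegral_sq2_swap {f : ℝ × ℝ → ℝ} (hf : Continuous f) :
    ∫ p in sq2, f p = ∫ y in 0..2 * π, ∫ x in 0..2 * π, f (x, y) := by
  have := setIntegral_sq2 (hf.comp continuous_swap)
  simp only [Function.comp_def, Prod.swap_prod_mk] at this
  rw [← this, sq2, Measure.volume_eq_prod, ← setIntegral_prod_swap]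

namespace SmoothPeriodic

variable {u v : ℝ × ℝ → ℝ}

lemma hasDerivAt_fst (hu : SmoothPeriodic u) (x y : ℝ) :
    HasDerivAt (fun s => u (s, y)) (_root_.pdx u (x, y)) x :=
  (hu.differentiable (x, y)).hasFDerivAt.comp_hasDerivAt x
    ((hasDerivAt_id x).prodMk (hasDerivAt_const x y))

lemma hasDerivAt_snd (hu : SmoothPeriodic u) (x y : ℝ) :
    HasDerivAt (fun t => u (x, t)) (_root_.pdy u (x, y)) y :=
  (hu.differentiable (x, y)).hasFDerivAt.comp_hasDerivAt y
    ((hasDerivAt_const y x).prodMk (hasDerivAt_id y))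

lemma integral_pdx (hu : SmoothPeriodic u) : ∫ p in sq2, _root_.pdx u p = 0 := by
  rw [setIntegral_sq2_swap hu.pdx.continuous]
  refine (intervalIntegral.integral_congr (g := fun _ => 0) fun y _ => ?_).trans (by simp)
  have hc : Continuous fun x => _root_.pdx u (x, y) := hu.pdx.continuous.comp (by fun_prop)
  simp only
  rw [intervalIntegral.integral_eq_sub_of_hasDerivAt (fun x _ => hu.hasDerivAt_fst x y)
    (hc.intervalIntegrable _ _)]
  have := hu.2.1 0 y
  simp_all

lemma integral_pdy (hu : SmoothPeriodic u) : ∫ p in sq2, _root_.pdy u p = 0 := by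
  rw [setIntegral_sq2 hu.pdy.continuous]
  refine (intervalIntegral.integral_congr (g := fun _ => 0) fun x _ => ?_).trans (by simp)
  have hc : Continuous fun y => _root_.pdy u (x, y) := hu.pdy.continuous.comp (by fun_prop)
  simp only
  rw [intervalIntegral.integral_eq_sub_of_hasDerivAt (fun y _ => hu.hasDerivAt_snd x y)
    (hc.intervalIntegrable _ _)]
  have := hu.2.2 x 0
  simp_all

lemma integral_pdx_mul (hu : SmoothPeriodic u) (hv : SmoothPeriodic v) :
    ∫ p in sq2, (_root_.pdx u p * v p + u p * _root_.pdx v p) = 0 := by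
  rw [← (hu.mul hv).integral_pdx]
  exact congrArg (fun f => ∫ p in sq2, f p) (hu.fderiv_mul_apply hv (1, 0)).symm

lemma integral_pdy_mul (hu : SmoothPeriodic u) (hv : SmoothPeriodic v) :
    ∫ p in sq2, (_root_.pdy u p * v p + u p * _root_.pdy v p) = 0 := by
  rw [← (hu.mul hv).integral_pdy]
  exact congrArg (fun f => ∫ p in sq2, f p) (hu.fderiv_mul_apply hv (0, 1)).symm

lemma pdx_pdy_comm (hu : SmoothPeriodic u) :
    _root_.pdx (_root_.pdy u) = _root_.pdy (_root_.pdx u) :=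
  funext fun p => hu.fderiv_apply_comm (0, 1) (1, 0) p

/-- The squared `H²` norm is the squared `L²` norm of `Au`. -/
lemma integral_sq_aop (hu : SmoothPeriodic u) :
    ∫ p in sq2, (Aop u p) ^ 2 = ∫ p in sq2, ((u p) ^ 2
      + 2 * (_root_.pdx u p) ^ 2 + 2 * (_root_.pdy u p) ^ 2
      + (_root_.pdx (_root_.pdx u) p) ^ 2 + 2 * (_root_.pdx (_root_.pdy u) p) ^ 2
      + (_root_.pdy (_root_.pdy u) p) ^ 2) := by
  have h₁ := hu.pdx.integral_pdx_mul hu.pdy.pdy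
  have h₂ := hu.pdx.integral_pdy_mul hu.pdx.pdy
  have h₃ := hu.integral_pdx_mul hu.pdx
  have h₄ := hu.integral_pdy_mul hu.pdy
  have hcomm : _root_.pdx (_root_.pdy (_root_.pdy u)) = _root_.pdy (_root_.pdy (_root_.pdx u)) := by
    rw [hu.pdy.pdx_pdy_comm, hu.pdx_pdy_comm]
  rw [hcomm] at h₁
  have c₀ := hu.continuous
  have c₁ := hu.pdx.continuous
  have c₂ := hu.pdy.continuous
  have c₃ := hu.pdx.pdx.continuous
  have c₄ := hu.pdx.pdy.continuous
  have c₅ := hu.pdy.pdy.continuous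
  have c₆ := hu.pdx.pdy.pdy.continuous
  rw [hu.pdx_pdy_comm]
  rw [← sub_eq_zero, ← integral_sub (integrableOn_sq2 (by unfold Aop; fun_prop))
    (integrableOn_sq2 (by fun_prop))]
  have key : ∫ p in sq2,
      (2 * (_root_.pdx (_root_.pdx u) p * _root_.pdy (_root_.pdy u) p
          + _root_.pdx u p * _root_.pdy (_root_.pdy (_root_.pdx u)) p)
        - 2 * (_root_.pdy (_root_.pdx u) p * _root_.pdy (_root_.pdx u) p
          + _root_.pdx u p * _root_.pdy (_root_.pdy (_root_.pdx u)) p)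
        - 2 * (_root_.pdx u p * _root_.pdx u p + u p * _root_.pdx (_root_.pdx u) p)
        - 2 * (_root_.pdy u p * _root_.pdy u p + u p * _root_.pdy (_root_.pdy u) p)) = 0 := by
    rw [integral_sub (integrableOn_sq2 (by fun_prop)) (integrableOn_sq2 (by fun_prop)),
      integral_sub (integrableOn_sq2 (by fun_prop)) (integrableOn_sq2 (by fun_prop)),
      integral_sub (integrableOn_sq2 (by fun_prop)) (integrableOn_sq2 (by fun_prop))]
    simp only [integral_const_mul, h₁, h₂, h₃, h₄]
    simp
  rw [← key]
  congr 1
  funext p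
  simp only [Aop]
  ring

lemma l2norm_le_l2norm_aop (hu : SmoothPeriodic u) (hv : Continuous v)
    (h : ∀ p, (v p) ^ 2 ≤ (u p) ^ 2
      + 2 * (_root_.pdx u p) ^ 2 + 2 * (_root_.pdy u p) ^ 2
      + (_root_.pdx (_root_.pdx u) p) ^ 2 + 2 * (_root_.pdx (_root_.pdy u) p) ^ 2
      + (_root_.pdy (_root_.pdy u) p) ^ 2) :
    l2norm v ≤ l2norm (Aop u) := by
  have c₀ := hu.continuous
  have c₁ := hu.pdx.continuous
  have c₂ := hu.pdy.continuous
  have c₃ := hu.pdx.pdx.continuous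
  have c₄ := hu.pdy.pdx.continuous
  have c₅ := hu.pdy.pdy.continuous
  refine Real.sqrt_le_sqrt ?_
  rw [hu.integral_sq_aop]
  exact integral_mono (integrableOn_sq2 (by fun_prop)) (integrableOn_sq2 (by fun_prop)) h

lemma l2norm_le (hu : SmoothPeriodic u) : l2norm u ≤ l2norm (Aop u) :=
  hu.l2norm_le_l2norm_aop hu.continuous fun p => by
    simp only [add_assoc, le_add_iff_nonneg_right]; positivity

lemma l2norm_pdx_le (hu : SmoothPeriodic u) : l2norm (_root_.pdx u) ≤ l2norm (Aop u) :=
  hu.l2norm_le_l2norm_aop hu.pdx.continuous fun p => by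
    rw [← sub_nonneg]; ring_nf; positivity

lemma l2norm_pdy_le (hu : SmoothPeriodic u) : l2norm (_root_.pdy u) ≤ l2norm (Aop u) :=
  hu.l2norm_le_l2norm_aop hu.pdy.continuous fun p => by
    rw [← sub_nonneg]; ring_nf; positivity

lemma l2norm_pdx_pdx_le (hu : SmoothPeriodic u) :
    l2norm (_root_.pdx (_root_.pdx u)) ≤ l2norm (Aop u) :=
  hu.l2norm_le_l2norm_aop hu.pdx.pdx.continuous fun p => by
    rw [← sub_nonneg]; ring_nf; positivity

lemma l2norm_pdx_pdy_le (hu : SmoothPeriodic u) :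
    l2norm (_root_.pdx (_root_.pdy u)) ≤ l2norm (Aop u) :=
  hu.l2norm_le_l2norm_aop hu.pdy.pdx.continuous fun p => by
    rw [← sub_nonneg]; ring_nf; positivity

lemma l2norm_pdy_pdy_le (hu : SmoothPeriodic u) :
    l2norm (_root_.pdy (_root_.pdy u)) ≤ l2norm (Aop u) :=
  hu.l2norm_le_l2norm_aop hu.pdy.pdy.continuous fun p => by
    rw [← sub_nonneg]; ring_nf; positivity

end SmoothPeriodic

lemma l2norm_nonneg (u : ℝ × ℝ → ℝ) : 0 ≤ l2norm u := Real.sqrt_nonneg _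

lemma integral_abs_le_l2norm {f : ℝ × ℝ → ℝ} (hf : Continuous f) :
    ∫ p in sq2, |f p| ≤ 2 * π * l2norm f := by
  have hπ := Real.pi_pos
  set J := ∫ p in sq2, |f p| with hJ
  have hexp : ∫ p in sq2, ((2 * π) ^ 2 * |f p| - J) ^ 2 =
      (2 * π) ^ 4 * (∫ p in sq2, (f p) ^ 2) - (2 * π) ^ 2 * J ^ 2 := by
    have : ∀ p, ((2 * π) ^ 2 * |f p| - J) ^ 2 =
        (2 * π) ^ 4 * (f p) ^ 2 - 2 * (2 * π) ^ 2 * J * |f p| + J ^ 2 := fun p => by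
      rw [← sq_abs (f p)]; ring
    simp only [this]
    rw [integral_add (integrableOn_sq2 (by fun_prop)) (integrableOn_sq2 (by fun_prop)),
      integral_sub (integrableOn_sq2 (by fun_prop)) (integrableOn_sq2 (by fun_prop)),
      integral_const_mul, integral_const_mul, ← hJ, setIntegral_const, volume_real_sq2,
      smul_eq_mul]
    ring
  have hnn : 0 ≤ ∫ p in sq2, ((2 * π) ^ 2 * |f p| - J) ^ 2 :=
    integral_nonneg fun p => sq_nonneg _
  have hle : J ^ 2 ≤ (2 * π) ^ 2 * ∫ p in sq2, (f p) ^ 2 := by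
    rw [hexp] at hnn
    have h4 : 0 < (2 * π) ^ 2 := by positivity
    nlinarith
  have := Real.sqrt_le_sqrt hle
  rw [Real.sqrt_mul (by positivity), Real.sqrt_sq (by positivity : 0 ≤ 2 * π)] at this
  exact (Real.le_sqrt_of_sq_le le_rfl).trans this

lemma l2norm_le_of_abs_le {f : ℝ × ℝ → ℝ} (hf : Continuous f) {K : ℝ} (hK : 0 ≤ K)
    (h : ∀ p ∈ sq2, |f p| ≤ K) : l2norm f ≤ 2 * π * K := by
  have hπ := Real.pi_pos
  refine Real.sqrt_le_iff.2 ⟨by positivity, ?_⟩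
  calc ∫ p in sq2, (f p) ^ 2 ≤ ∫ _ in sq2, K ^ 2 :=
        setIntegral_mono_on (integrableOn_sq2 (by fun_prop)) (integrableOn_sq2 (by fun_prop))
          measurableSet_sq2 fun p hp => by
            rw [← sq_abs]; exact pow_le_pow_left₀ (abs_nonneg _) (h p hp) 2
    _ = (2 * π * K) ^ 2 := by
        rw [setIntegral_const, volume_real_sq2, smul_eq_mul]; ring

/-- The embedding of `W^{1,1}` into `L^∞` on `[0, 2π]`. -/
lemma abs_le_integral_abs_add {g g' : ℝ → ℝ} (hg : ∀ x, HasDerivAt g (g' x) x)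
    (hg' : Continuous g') {x : ℝ} (hx : x ∈ Set.Icc 0 (2 * π)) :
    |g x| ≤ ∫ s in 0..2 * π, (|g s| + |g' s|) := by
  have hπ : 1 ≤ 2 * π := by linarith [Real.pi_gt_three]
  have hgc : Continuous g := continuous_iff_continuousAt.2 fun x => (hg x).continuousAt
  set D := ∫ s in 0..2 * π, |g' s| with hD
  have hpt : ∀ y ∈ Set.Icc 0 (2 * π), |g x| ≤ |g y| + D := by
    intro y hy
    have h := intervalIntegral.integral_eq_sub_of_hasDerivAt (fun s _ => hg s)
      (hg'.intervalIntegrable y x)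
    have h₁ : |∫ s in y..x, g' s| ≤ |(∫ s in y..x, |g' s|)| :=
      intervalIntegral.norm_integral_le_abs_integral_norm (f := g')
    have h₂ : |(∫ s in y..x, |g' s|)| ≤ |(∫ s in 0..2 * π, |g' s|)| := by
      refine intervalIntegral.abs_integral_mono_interval ?_
        (Eventually.of_forall fun s => abs_nonneg _) (hg'.abs.intervalIntegrable _ _)
      rw [Set.uIoc_of_le (by linarith : 0 ≤ 2 * π)]
      exact Set.Ioc_subset_Ioc (le_min hy.1 hx.1) (max_le hy.2 hx.2)
    have hD₀ : 0 ≤ D := intervalIntegral.integral_nonneg (by linarith) fun s _ => abs_nonneg (g' s)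
    rw [← hD, abs_of_nonneg hD₀] at h₂
    have h₃ : |g x| ≤ |g y| + |g x - g y| := by
      simpa using abs_add_le (g y) (g x - g y)
    rw [← h] at h₃
    linarith
  have hint : ∫ _ in 0..2 * π, |g x| ≤ ∫ y in 0..2 * π, (|g y| + D) :=
    intervalIntegral.integral_mono_on (by linarith) (by simp)
      (Continuous.intervalIntegrable (by fun_prop) _ _) hpt
  rw [intervalIntegral.integral_add (Continuous.intervalIntegrable (by fun_prop) _ _) (by simp)]
    at hint
  simp only [intervalIntegral.integral_const, sub_zero, smul_eq_mul] at hint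
  rw [intervalIntegral.integral_add (Continuous.intervalIntegrable (by fun_prop) _ _)
    (Continuous.intervalIntegrable (by fun_prop) _ _), ← hD]
  have hG : 0 ≤ ∫ s in 0..2 * π, |g s| :=
    intervalIntegral.integral_nonneg (by linarith) fun s _ => abs_nonneg (g s)
  have : 2 * π * |g x| ≤ 2 * π * ((∫ s in 0..2 * π, |g s|) + D) := by nlinarith
  exact le_of_mul_le_mul_left this (by linarith)

namespace SmoothPeriodic

variable {u v : ℝ × ℝ → ℝ}

/-- The Sobolev embedding of `H²` into `L^∞`. -/
lemma abs_le_l2norm_aop (hu : SmoothPeriodic u) {p : ℝ × ℝ} (hp : p ∈ sq2) :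
    |u p| ≤ 8 * π * l2norm (Aop u) := by
  have hπ : 0 < 2 * π := by positivity
  obtain ⟨x, y⟩ := p
  have c₀ := hu.continuous
  have c₁ := hu.pdx.continuous
  have c₂ := hu.pdy.continuous
  have c₃ := hu.pdy.pdx.continuous
  have hslice : ∀ w : ℝ × ℝ → ℝ, SmoothPeriodic w → ∀ t,
      |w (x, t)| ≤ ∫ s in 0..2 * π, (|w (s, t)| + |_root_.pdx w (s, t)|) := fun w hw t =>
    abs_le_integral_abs_add (fun s => hw.hasDerivAt_fst s t)
      (hw.pdx.continuous.comp (by fun_prop : Continuous fun s : ℝ => (s, t))) hp.1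
  have hcont : ∀ w : ℝ × ℝ → ℝ, SmoothPeriodic w →
      Continuous fun t => ∫ s in 0..2 * π, (|w (s, t)| + |_root_.pdx w (s, t)|) := by
    intro w hw
    have := hw.continuous
    have := hw.pdx.continuous
    exact intervalIntegral.continuous_parametric_intervalIntegral_of_continuous'
      (by fun_prop) _ _
  have hint : ∀ w : ℝ × ℝ → ℝ, SmoothPeriodic w →
      ∫ t in 0..2 * π, |w (x, t)| ≤ 2 * π * (l2norm w + l2norm (_root_.pdx w)) := by
    intro w hw
    have d₀ := hw.continuous
    have d₁ := hw.pdx.continuous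
    calc ∫ t in 0..2 * π, |w (x, t)|
        ≤ ∫ t in 0..2 * π, ∫ s in 0..2 * π, (|w (s, t)| + |_root_.pdx w (s, t)|) :=
          intervalIntegral.integral_mono_on hπ.le
            (Continuous.intervalIntegrable (by fun_prop) _ _)
            ((hcont w hw).intervalIntegrable _ _) fun t _ => hslice w hw t
      _ = ∫ p in sq2, (|w p| + |_root_.pdx w p|) :=
          (setIntegral_sq2_swap (f := fun p => |w p| + |_root_.pdx w p|) (by fun_prop)).symm
      _ = (∫ p in sq2, |w p|) + ∫ p in sq2, |_root_.pdx w p| :=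
          integral_add (integrableOn_sq2 (by fun_prop)) (integrableOn_sq2 (by fun_prop))
      _ ≤ _ := by
          have := integral_abs_le_l2norm d₀
          have := integral_abs_le_l2norm d₁
          linarith
  have h₀ : |u (x, y)| ≤ ∫ t in 0..2 * π, (|u (x, t)| + |_root_.pdy u (x, t)|) :=
    abs_le_integral_abs_add (g' := fun t => _root_.pdy u (x, t))
      (fun t => hu.hasDerivAt_snd x t) (by fun_prop) hp.2
  rw [intervalIntegral.integral_add (Continuous.intervalIntegrable (by fun_prop) _ _)
    (Continuous.intervalIntegrable (by fun_prop) _ _)] at h₀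
  have h₁ := hint u hu
  have h₂ := hint _ hu.pdy
  have := hu.l2norm_le
  have := hu.l2norm_pdx_le
  have := hu.l2norm_pdy_le
  have := hu.l2norm_pdx_pdy_le
  nlinarith

lemma l2norm_le_iterate_aop (hu : SmoothPeriodic u) (n : ℕ) : l2norm u ≤ l2norm (Aop^[n] u) := by
  induction n with
  | zero => rfl
  | succ n ih =>
    rw [Function.iterate_succ_apply']
    exact ih.trans (hu.iterate_aop n).l2norm_le

end SmoothPeriodic

/-- All partial derivatives of `u` of order at most `k` are bounded by `M` on `sq2`. -/
def DerivBound : ℕ → ℝ → (ℝ × ℝ → ℝ) → Prop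
  | 0, M, u => ∀ p ∈ sq2, |u p| ≤ M
  | k + 1, M, u => (∀ p ∈ sq2, |u p| ≤ M) ∧ DerivBound k M (pdx u) ∧ DerivBound k M (pdy u)

namespace DerivBound

variable {u v : ℝ × ℝ → ℝ} {k : ℕ} {M N : ℝ}

lemma abs_le (h : DerivBound k M u) : ∀ p ∈ sq2, |u p| ≤ M := by
  cases k with
  | zero => exact h
  | succ k => exact h.1

lemma nonneg (h : DerivBound k M u) : 0 ≤ M :=
  (abs_nonneg _).trans (h.abs_le (0, 0) (by simp [sq2, Real.pi_pos.le]))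

lemma mono_const (h : DerivBound k M u) (hMN : M ≤ N) : DerivBound k N u := by
  induction k generalizing u with
  | zero => exact fun p hp => (h p hp).trans hMN
  | succ k ih => exact ⟨fun p hp => (h.1 p hp).trans hMN, ih h.2.1, ih h.2.2⟩

lemma of_succ (h : DerivBound (k + 1) M u) : DerivBound k M u := by
  induction k generalizing u with
  | zero => exact h.1
  | succ k ih => exact ⟨h.1, ih h.2.1, ih h.2.2⟩

lemma neg (h : DerivBound k M u) : DerivBound k M fun p => -u p := by
  induction k generalizing u with
  | zero => exact fun p hp => by simpa using h p hp
  | succ k ih =>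
    refine ⟨fun p hp => by simpa using h.1 p hp, ?_, ?_⟩
    · exact (congrArg (DerivBound k _) (SmoothPeriodic.fderiv_neg_apply u (1, 0))).mpr (ih h.2.1)
    · exact (congrArg (DerivBound k _) (SmoothPeriodic.fderiv_neg_apply u (0, 1))).mpr (ih h.2.2)

lemma add (hu : SmoothPeriodic u) (hv : SmoothPeriodic v) (h : DerivBound k M u)
    (h' : DerivBound k N v) : DerivBound k (M + N) fun p => u p + v p := by
  have h₀ : ∀ p ∈ sq2, |u p + v p| ≤ M + N := fun p hp =>
    (abs_add_le _ _).trans (add_le_add (h.abs_le p hp) (h'.abs_le p hp))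
  induction k generalizing u v with
  | zero => exact h₀
  | succ k ih =>
    refine ⟨h₀, ?_, ?_⟩
    · have := ih hu.pdx hv.pdx h.2.1 h'.2.1 fun p hp =>
        (abs_add_le _ _).trans (add_le_add (h.2.1.abs_le p hp) (h'.2.1.abs_le p hp))
      exact (congrArg (DerivBound k _) (hu.fderiv_add_apply hv (1, 0))).mpr this
    · have := ih hu.pdy hv.pdy h.2.2 h'.2.2 fun p hp =>
        (abs_add_le _ _).trans (add_le_add (h.2.2.abs_le p hp) (h'.2.2.abs_le p hp))
      exact (congrArg (DerivBound k _) (hu.fderiv_add_apply hv (0, 1))).mpr this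

lemma mul (hu : SmoothPeriodic u) (hv : SmoothPeriodic v) (h : DerivBound k M u)
    (h' : DerivBound k N v) : DerivBound k (2 ^ k * (M * N)) fun p => u p * v p := by
  have hM := h.nonneg
  have hN := h'.nonneg
  induction k generalizing u v with
  | zero =>
    intro p hp
    rw [abs_mul, pow_zero, one_mul]
    exact mul_le_mul (h p hp) (h' p hp) (abs_nonneg _) hM
  | succ k ih =>
    have h2 : (2 : ℝ) ^ k * (M * N) + 2 ^ k * (M * N) = 2 ^ (k + 1) * (M * N) := by ring
    rw [← h2]
    refine ⟨fun p hp => ?_, ?_, ?_⟩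
    · have := (ih hu hv h.of_succ h'.of_succ).abs_le p hp
      have h0 : 0 ≤ (2 : ℝ) ^ k * (M * N) := by positivity
      linarith
    · have := add (hu.pdx.mul hv) (hu.mul hv.pdx) (ih hu.pdx hv h.2.1 h'.of_succ)
        (ih hu hv.pdx h.of_succ h'.2.1)
      exact (congrArg (DerivBound k _) (hu.fderiv_mul_apply hv (1, 0))).mpr this
    · have := add (hu.pdy.mul hv) (hu.mul hv.pdy) (ih hu.pdy hv h.2.2 h'.of_succ)
        (ih hu hv.pdy h.of_succ h'.2.2)
      exact (congrArg (DerivBound k _) (hu.fderiv_mul_apply hv (0, 1))).mpr this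

lemma aop (hu : SmoothPeriodic u) (h : DerivBound (k + 2) M u) :
    DerivBound k (3 * M) (Aop u) := by
  have := add (hu.pdx.pdx.add hu.pdy.pdy).neg hu
    (DerivBound.add hu.pdx.pdx hu.pdy.pdy h.2.1.2.1 h.2.2.2.2).neg h.of_succ.of_succ
  exact this.mono_const (by linarith)

lemma iterate_aop (hu : SmoothPeriodic u) {n : ℕ} (h : DerivBound (2 * n) M u) :
    ∀ p ∈ sq2, |Aop^[n] u p| ≤ 3 ^ n * M := by
  induction n generalizing u M with
  | zero => simpa using h.abs_le
  | succ n ih =>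
    intro p hp
    have := ih hu.aop (h.aop hu) p hp
    rw [Function.iterate_succ_apply, pow_succ, mul_assoc]
    exact this

end DerivBound

lemma SmoothPeriodic.derivBound {u : ℝ × ℝ → ℝ} (hu : SmoothPeriodic u) (n : ℕ) :
    DerivBound (2 * n) (8 * π * l2norm (Aop^[n + 1] u)) u := by
  have hπ : 0 ≤ 8 * π := by positivity
  induction n generalizing u with
  | zero => exact fun p hp => hu.abs_le_l2norm_aop hp
  | succ n ih =>
    have hsup : ∀ p ∈ sq2, |u p| ≤ 8 * π * l2norm (Aop^[n + 2] u) := fun p hp => by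
      refine (hu.abs_le_l2norm_aop hp).trans (mul_le_mul_of_nonneg_left ?_ hπ)
      rw [Function.iterate_succ_apply]
      exact hu.aop.l2norm_le_iterate_aop (n + 1)
    have hfst : ∀ e, (∀ w, SmoothPeriodic w → l2norm (fun p => fderiv ℝ w p e) ≤ l2norm (Aop w)) →
        ∀ p ∈ sq2, |fderiv ℝ u p e| ≤ 8 * π * l2norm (Aop^[n + 2] u) := fun e he p hp => by
      refine ((hu.fderiv_apply e).abs_le_l2norm_aop hp).trans (mul_le_mul_of_nonneg_left ?_ hπ)
      rw [← hu.fderiv_aop_apply, Function.iterate_succ_apply, Function.iterate_succ_apply]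
      exact (he _ hu.aop).trans (hu.aop.aop.l2norm_le_iterate_aop n)
    have hsnd : ∀ e e', (∀ w, SmoothPeriodic w →
        l2norm (fun p => fderiv ℝ (fun q => fderiv ℝ w q e) p e') ≤ l2norm (Aop w)) →
        DerivBound (2 * n) (8 * π * l2norm (Aop^[n + 2] u))
          (fun p => fderiv ℝ (fun q => fderiv ℝ u q e) p e') := fun e e' he => by
      refine (ih ((hu.fderiv_apply e).fderiv_apply e')).mono_const
        (mul_le_mul_of_nonneg_left ?_ hπ)
      rw [← (hu.fderiv_apply e).fderiv_iterate_aop_apply, ← hu.fderiv_iterate_aop_apply,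
        Function.iterate_succ_apply' _ (n + 1)]
      exact he _ (hu.iterate_aop (n + 1))
    refine ⟨hsup, ⟨hfst _ fun w hw => hw.l2norm_pdx_le, ?_, ?_⟩,
      ⟨hfst _ fun w hw => hw.l2norm_pdy_le, ?_, ?_⟩⟩
    · exact hsnd _ _ fun w hw => hw.l2norm_pdx_pdx_le
    · exact hsnd _ _ fun w hw => (congrArg l2norm hw.pdx_pdy_comm).ge.trans hw.l2norm_pdx_pdy_le
    · exact hsnd _ _ fun w hw => hw.l2norm_pdx_pdy_le
    · exact hsnd _ _ fun w hw => hw.l2norm_pdy_pdy_le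

/-- Estimate for `‖A^{m−1}(v(u₁² + u₁u₂ + u₂²))‖²`. -/
theorem stmt_11 (m : ℕ) (hm : 1 ≤ m) :
    ∃ c > 0, ∀ v u₁ u₂ : ℝ × ℝ → ℝ,
      SmoothPeriodic v → SmoothPeriodic u₁ → SmoothPeriodic u₂ →
      l2norm (Aop^[m - 1]
          (fun p => v p * ((u₁ p) ^ 2 + u₁ p * u₂ p + (u₂ p) ^ 2))) ^ 2 ≤
        c * l2norm (Aop^[m] v) ^ 2 *
          (l2norm (Aop^[m] u₁) ^ 4 + l2norm (Aop^[m] u₂) ^ 4) := by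
  obtain ⟨n, rfl⟩ : ∃ n, m = n + 1 := ⟨m - 1, by omega⟩
  rw [Nat.add_sub_cancel]
  have hπ := Real.pi_pos
  set K : ℝ := 2 * π * (3 ^ n * (2 ^ (2 * n) * (8 * π * (2 ^ (2 * n) * (8 * π) ^ 2)))) with hK
  refine ⟨K ^ 2 * (9 / 2), by positivity, fun v u₁ u₂ hv h₁ h₂ => ?_⟩
  set V := l2norm (Aop^[n + 1] v)
  set a := l2norm (Aop^[n + 1] u₁)
  set b := l2norm (Aop^[n + 1] u₂)
  have hV : 0 ≤ V := l2norm_nonneg _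
  have ha : 0 ≤ a := l2norm_nonneg _
  have hb : 0 ≤ b := l2norm_nonneg _
  simp only [pow_two (u₁ _), pow_two (u₂ _)]
  have hq := ((h₁.mul h₁).add (h₁.mul h₂)).add (h₂.mul h₂)
  have hvq := hv.mul hq
  have bd₁ := h₁.derivBound n
  have bd₂ := h₂.derivBound n
  have bq := DerivBound.add ((h₁.mul h₁).add (h₁.mul h₂)) (h₂.mul h₂)
    (DerivBound.add (h₁.mul h₁) (h₁.mul h₂) (bd₁.mul h₁ h₁ bd₁) (bd₁.mul h₁ h₂ bd₂))
    (bd₂.mul h₂ h₂ bd₂)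
  have bvq := (hv.derivBound n).mul hv hq bq
  have hle := l2norm_le_of_abs_le (hvq.iterate_aop n).continuous
    (mul_nonneg (by positivity) bvq.nonneg) (bvq.iterate_aop hvq)
  have hle' : l2norm (Aop^[n] fun p => v p * (u₁ p * u₁ p + u₁ p * u₂ p + u₂ p * u₂ p)) ≤
      K * V * (a ^ 2 + a * b + b ^ 2) := hle.trans_eq (by rw [hK]; ring)
  have hab : (a ^ 2 + a * b + b ^ 2) ^ 2 ≤ 9 / 2 * (a ^ 4 + b ^ 4) := by
    have h3 : a ^ 2 + a * b + b ^ 2 ≤ 3 / 2 * (a ^ 2 + b ^ 2) := by nlinarith [sq_nonneg (a - b)]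
    have := pow_le_pow_left₀ (by positivity) h3 2
    nlinarith [sq_nonneg (a ^ 2 - b ^ 2)]
  calc _ ≤ (K * V * (a ^ 2 + a * b + b ^ 2)) ^ 2 := pow_le_pow_left₀ (l2norm_nonneg _) hle' 2
    _ = (K * V) ^ 2 * (a ^ 2 + a * b + b ^ 2) ^ 2 := by ring
    _ ≤ (K * V) ^ 2 * (9 / 2 * (a ^ 4 + b ^ 4)) := by gcongr
    _ = _ := by ring
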